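/- Let n be odd. Then n² · (|RELS(n)| − |ROLS(n)|) = Σ_{k=0}^{(n−1)/2} Σ_{m=0}^{(n−1)/2} (−1)^{k+m} (n−2k)(n−2m) N_n(k,m), where RELS(n) and ROLS(n) are the sets of even and odd reduced Latin squares of order n respectively, and N_n(k,m) is the number of reduced Latin squares of order n with parity type (k,m). -/

import Mathlib

open Equiv Finset

/-- A Latin square of order `n`: an `n × n` array of symbols from `Fin n`
such that every symbol occurs exactly once in each row and each column. -/
structure LatinSquare (n : ℕ) where
  entry : Fin n → Fin n → Fin n
  row_bij : ∀ r : Fin n, Function.Bijective fun c => entry r c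
  col_bij : ∀ c : Fin n, Function.Bijective fun r => entry r c

namespace LatinSquare

variable {n : ℕ}

/-- Row `r` of `L` as a permutation: `rowPerm L r i = j ↔ L r j = i`. -/
noncomputable def rowPerm (L : LatinSquare n) (r : Fin n) : Equiv.Perm (Fin n) :=
  (Equiv.ofBijective _ (L.row_bij r)).symm

/-- Column `c` of `L` as a permutation: `colPerm L c i = j ↔ L j c = i`. -/
noncomputable def colPerm (L : LatinSquare n) (c : Fin n) : Equiv.Perm (Fin n) :=
  (Equiv.ofBijective _ (L.col_bij c)).symm

/-- The isotopism `(α, β, γ)` applied to `L`: `α` permutes rows, `β` permutes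
columns, `γ` permutes symbols. -/
def isotope (α β γ : Equiv.Perm (Fin n)) (L : LatinSquare n) : LatinSquare n where
  entry r c := γ (L.entry (α⁻¹ r) (β⁻¹ c))
  row_bij r := by
    have h : (fun c => γ (L.entry (α⁻¹ r) (β⁻¹ c))) =
        (γ : Fin n → Fin n) ∘ (fun c => L.entry (α⁻¹ r) c) ∘ (β⁻¹ : Equiv.Perm (Fin n)) := rfl
    rw [h]
    exact (γ.bijective.comp (L.row_bij _)).comp (β⁻¹).bijective
  col_bij c := by
    have h : (fun r => γ (L.entry (α⁻¹ r) (β⁻¹ c))) =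
        (γ : Fin n → Fin n) ∘ (fun r => L.entry r (β⁻¹ c)) ∘ (α⁻¹ : Equiv.Perm (Fin n)) := rfl
    rw [h]
    exact (γ.bijective.comp (L.col_bij _)).comp (α⁻¹).bijective

/-- `L'` is isotopic to `L` if some isotopism transforms `L` into `L'`. -/
def Isotopic (L L' : LatinSquare n) : Prop :=
  ∃ α β γ : Equiv.Perm (Fin n), isotope α β γ L = L'

/-- A Latin square is reduced if its first row and first column are the identity. -/
def Reduced [NeZero n] (L : LatinSquare n) : Prop :=
  L.rowPerm 0 = 1 ∧ L.colPerm 0 = 1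

/-- The parity of `L`: the product of the signs of all rows and all columns. -/
noncomputable def par (L : LatinSquare n) : ℤˣ :=
  (∏ r : Fin n, Equiv.Perm.sign (L.rowPerm r)) * ∏ c : Fin n, Equiv.Perm.sign (L.colPerm c)

/-- The parity type `(k, m)` of `L`: `k` is the minimum of the number of even rows
and the number of odd rows, `m` is the analogous quantity for columns. -/
noncomputable def parityType (L : LatinSquare n) : ℕ × ℕ :=
  (min (univ.filter fun r => Equiv.Perm.sign (L.rowPerm r) = 1).card
      (univ.filter fun r => Equiv.Perm.sign (L.rowPerm r) = -1).card,
   min (univ.filter fun c => Equiv.Perm.sign (L.colPerm c) = 1).card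
      (univ.filter fun c => Equiv.Perm.sign (L.colPerm c) = -1).card)

end LatinSquare

/-- The number of autotopisms of `L`, i.e. the order of the autotopy group `𝔄(L)`. -/
noncomputable def autotopyCard {n : ℕ} (L : LatinSquare n) : ℕ :=
  Nat.card {Θ : Equiv.Perm (Fin n) × Equiv.Perm (Fin n) × Equiv.Perm (Fin n) //
    LatinSquare.isotope Θ.1 Θ.2.1 Θ.2.2 L = L}

namespace LatinSquare

theorem perm_inv_app {α : Type*} (e : Equiv.Perm α) (x : α) : e⁻¹ (e x) = x :=
  e.symm_apply_apply x

theorem perm_app_inv {α : Type*} (e : Equiv.Perm α) (x : α) : e (e⁻¹ x) = x :=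
  e.apply_symm_apply x

theorem entry_injective {n : ℕ} : Function.Injective (entry : LatinSquare n → _) := by
  rintro ⟨a, _, _⟩ ⟨b, _, _⟩ h
  cases h
  rfl

instance finiteLS {n : ℕ} : Finite (LatinSquare n) :=
  Finite.of_injective _ entry_injective

theorem rowPerm_eq {n : ℕ} (L : LatinSquare n) (r : Fin n) (p : Equiv.Perm (Fin n))
    (h : ∀ j, p (L.entry r j) = j) : L.rowPerm r = p := by
  ext1 x
  obtain ⟨j, rfl⟩ := (L.row_bij r).2 x
  refine Eq.trans ?_ (h j).symm
  exact (Equiv.ofBijective _ (L.row_bij r)).symm_apply_apply j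

theorem rowPerm_entry {n : ℕ} (L : LatinSquare n) (r j : Fin n) :
    L.rowPerm r (L.entry r j) = j :=
  (Equiv.ofBijective _ (L.row_bij r)).symm_apply_apply j

theorem colPerm_eq {n : ℕ} (L : LatinSquare n) (c : Fin n) (p : Equiv.Perm (Fin n))
    (h : ∀ j, p (L.entry j c) = j) : L.colPerm c = p := by
  ext1 x
  obtain ⟨j, rfl⟩ := (L.col_bij c).2 x
  refine Eq.trans ?_ (h j).symm
  exact (Equiv.ofBijective _ (L.col_bij c)).symm_apply_apply j

theorem colPerm_entry {n : ℕ} (L : LatinSquare n) (j c : Fin n) :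
    L.colPerm c (L.entry j c) = j :=
  (Equiv.ofBijective _ (L.col_bij c)).symm_apply_apply j

theorem colPerm_inv {n : ℕ} (L : LatinSquare n) (j c : Fin n) :
    (L.colPerm c)⁻¹ j = L.entry j c := by
  rw [Equiv.Perm.inv_eq_iff_eq, colPerm_entry]

theorem rowPerm_isotope {n : ℕ} (L : LatinSquare n) (α β γ : Equiv.Perm (Fin n)) (r : Fin n) :
    (isotope α β γ L).rowPerm r = β * L.rowPerm (α⁻¹ r) * γ⁻¹ := by
  apply rowPerm_eq
  intro j
  simp only [isotope, Equiv.Perm.mul_apply, perm_inv_app, rowPerm_entry,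
    perm_app_inv]

theorem colPerm_isotope {n : ℕ} (L : LatinSquare n) (α β γ : Equiv.Perm (Fin n)) (c : Fin n) :
    (isotope α β γ L).colPerm c = α * L.colPerm (β⁻¹ c) * γ⁻¹ := by
  apply colPerm_eq
  intro j
  simp only [isotope, Equiv.Perm.mul_apply, perm_inv_app, colPerm_entry,
    perm_app_inv]

theorem units_odd_pow {n : ℕ} (hn : Odd n) (u : ℤˣ) : u ^ n = u := by
  rcases Int.units_eq_one_or u with rfl | rfl
  · simp
  · exact hn.neg_one_pow

theorem par_isotope {n : ℕ} (hn : Odd n) (L : LatinSquare n) (α β γ : Equiv.Perm (Fin n)) :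
    (isotope α β γ L).par = L.par * (Equiv.Perm.sign α * Equiv.Perm.sign β) := by
  unfold par
  simp only [rowPerm_isotope, colPerm_isotope, Equiv.Perm.sign_mul, Finset.prod_mul_distrib,
    Finset.prod_const, Finset.card_univ, Fintype.card_fin, units_odd_pow hn, Equiv.Perm.sign_inv]
  rw [Equiv.prod_comp α⁻¹ (fun r => Equiv.Perm.sign (L.rowPerm r)),
    Equiv.prod_comp β⁻¹ (fun r => Equiv.Perm.sign (L.colPerm r))]
  have h := Int.units_mul_self (Equiv.Perm.sign γ)
  generalize Equiv.Perm.sign γ = g at *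
  generalize Equiv.Perm.sign β = b
  generalize Equiv.Perm.sign α = a
  generalize (∏ r : Fin n, Equiv.Perm.sign (L.rowPerm r)) = x
  generalize (∏ r : Fin n, Equiv.Perm.sign (L.colPerm r)) = y
  calc b * x * g * (a * y * g) = x * y * (a * b) * (g * g) := by
        simp only [mul_comm, mul_left_comm, mul_assoc]
    _ = _ := by rw [h, mul_one]

variable {n : ℕ} [NeZero n]

noncomputable def gam (r c : Fin n) (L : LatinSquare n) : Equiv.Perm (Fin n) :=
  Equiv.swap 0 c * L.rowPerm r

noncomputable def alp (r c : Fin n) (L : LatinSquare n) : Equiv.Perm (Fin n) :=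
  gam r c L * (L.colPerm c)⁻¹

noncomputable def phi (r c : Fin n) (L : LatinSquare n) : LatinSquare n :=
  isotope (alp r c L) (Equiv.swap 0 c) (gam r c L) L

theorem alp_apply (r c : Fin n) (L : LatinSquare n) (i : Fin n) :
    alp r c L i = gam r c L (L.entry i c) := by
  rw [alp, Equiv.Perm.mul_apply, colPerm_inv]

theorem alp_r (r c : Fin n) (L : LatinSquare n) : alp r c L r = 0 := by
  rw [alp_apply, gam, Equiv.Perm.mul_apply, rowPerm_entry, Equiv.swap_apply_right]

theorem alp_inv_zero (r c : Fin n) (L : LatinSquare n) : (alp r c L)⁻¹ 0 = r := by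
  rw [Equiv.Perm.inv_eq_iff_eq, alp_r]

theorem phi_reduced (r c : Fin n) (L : LatinSquare n) : (phi r c L).Reduced := by
  constructor
  · rw [phi, rowPerm_isotope, alp_inv_zero, gam, mul_inv_cancel]
  · rw [phi, colPerm_isotope, alp, Equiv.swap_inv, Equiv.swap_apply_left]
    group

theorem phi_par (hn : Odd n) (r c : Fin n) (L : LatinSquare n) :
    (phi r c L).par = L.par * (Equiv.Perm.sign (L.rowPerm r) * Equiv.Perm.sign (L.colPerm c)) := by
  rw [phi, par_isotope hn, alp, gam]
  simp only [Equiv.Perm.sign_mul, Equiv.Perm.sign_inv]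
  have h := Int.units_mul_self (Equiv.Perm.sign (Equiv.swap 0 c))
  generalize Equiv.Perm.sign (Equiv.swap 0 c) = g at *
  generalize Equiv.Perm.sign (L.rowPerm r) = a
  generalize Equiv.Perm.sign (L.colPerm c) = b
  calc L.par * (g * a * b * g) = L.par * (a * b) * (g * g) := by
        simp only [mul_comm, mul_left_comm, mul_assoc]
    _ = _ := by rw [h, mul_one]

theorem phi_entry (r c : Fin n) (L : LatinSquare n) (i j : Fin n) :
    (phi r c L).entry (alp r c L i) (Equiv.swap 0 c j) = gam r c L (L.entry i j) := by
  simp only [phi, isotope, perm_inv_app]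

theorem Reduced.row {L : LatinSquare n} (h : L.Reduced) (j : Fin n) : L.entry 0 j = j := by
  have := L.rowPerm_entry 0 j
  rwa [h.1] at this

theorem Reduced.col {L : LatinSquare n} (h : L.Reduced) (j : Fin n) : L.entry j 0 = j := by
  have := L.colPerm_entry j 0
  rwa [h.2] at this

theorem phi_inj (r c : Fin n) (L K : LatinSquare n) (hL : L.Reduced) (hK : K.Reduced)
    (h : phi r c L = phi r c K) : L = K := by
  have key : ∀ L : LatinSquare n, L.Reduced →
      (phi r c L).entry (alp r c L 0) (Equiv.swap 0 c r) = Equiv.swap 0 c 0 := by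
    intro L hL
    have h1 := phi_entry r c L r 0
    rw [alp_r, hL.col, (phi_reduced r c L).row] at h1
    rw [phi_entry, hL.row, h1]
  have ha : alp r c L 0 = alp r c K 0 := by
    apply ((phi r c K).col_bij (Equiv.swap 0 c r)).1
    have h1 := key L hL
    rw [h] at h1
    exact h1.trans (key K hK).symm
  have hg : gam r c L = gam r c K := by
    ext1 x
    have h1 := phi_entry r c L 0 x
    have h2 := phi_entry r c K 0 x
    rw [hL.row] at h1
    rw [hK.row] at h2
    rw [← h1, ← h2, h, ha]
  have hal : alp r c L = alp r c K := by
    ext1 x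
    apply ((phi r c K).col_bij (Equiv.swap 0 c 0)).1
    have h1 := phi_entry r c L x 0
    have h2 := phi_entry r c K x 0
    rw [hL.col, h, hg] at h1
    rw [hK.col] at h2
    exact h1.trans h2.symm
  apply entry_injective
  funext i j
  have h1 := phi_entry r c L i j
  have h2 := phi_entry r c K i j
  apply (gam r c K).injective
  rw [← h2, ← hal, ← h, h1, hg]

/-- sign identity for a family of signs over an odd index set -/
theorem sign_sum (hn : Odd n) (s : Fin n → ℤˣ) :
    (-1 : ℤ) ^ (min (univ.filter fun r => s r = 1).card (univ.filter fun r => s r = -1).card) *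
      ((n : ℤ) - 2 * (min (univ.filter fun r => s r = 1).card
        (univ.filter fun r => s r = -1).card : ℕ)) =
    ((∏ r, s r : ℤˣ) : ℤ) * ∑ r, (s r : ℤ) ∧
    min (univ.filter fun r => s r = 1).card (univ.filter fun r => s r = -1).card
      < (n - 1) / 2 + 1 := by
  have hf : (univ.filter fun r => s r = -1) = (univ.filter fun r => ¬ s r = 1) := by
    apply Finset.filter_congr
    intro r _
    rcases Int.units_eq_one_or (s r) with h | h <;> simp [h]
  have hc : (univ.filter fun r => s r = 1).card + (univ.filter fun r => s r = -1).card = n := by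
    rw [hf, Finset.card_filter_add_card_filter_not]
    simp
  have hs : ∑ r, (s r : ℤ) = (univ.filter fun r => s r = 1).card
      - (univ.filter fun r => s r = -1).card := by
    rw [Finset.card_filter, Finset.card_filter]
    push_cast
    rw [← Finset.sum_sub_distrib]
    apply Finset.sum_congr rfl
    intro r _
    rcases Int.units_eq_one_or (s r) with h | h <;> simp [h]
  have hp : ((∏ r, s r : ℤˣ) : ℤ) = (-1) ^ (univ.filter fun r => s r = -1).card := by
    have : (∏ r, s r : ℤˣ) = (-1) ^ (univ.filter fun r => s r = -1).card := by
      rw [← Finset.prod_const, Finset.prod_filter]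
      apply Finset.prod_congr rfl
      intro r _
      rcases Int.units_eq_one_or (s r) with h | h <;> simp [h]
    rw [this]
    simp
  rw [hs, hp]
  generalize (univ.filter fun r => s r = 1).card = a at *
  generalize (univ.filter fun r => s r = -1).card = b at *
  refine ⟨?_, by obtain ⟨t, ht⟩ := hn; omega⟩
  rcases le_total a b with hab | hab
  · rw [min_eq_left hab]
    have : (-1 : ℤ) ^ a = - (-1) ^ b := by
      have h1 : (-1 : ℤ) ^ (a + b) = -1 := by rw [hc]; exact hn.neg_one_pow
      rw [pow_add] at h1
      rcases neg_one_pow_eq_or ℤ a with h | h <;> rcases neg_one_pow_eq_or ℤ b with h' | h' <;>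
        simp [h, h'] at h1 ⊢
    rw [this, ← hc]
    push_cast
    ring
  · rw [min_eq_right hab, ← hc]
    push_cast
    ring

theorem sum_shift (hn : Odd n) [Fintype {L : LatinSquare n // L.Reduced}] (r c : Fin n) :
    ∑ L : {L : LatinSquare n // L.Reduced}, ((L.1.par : ℤ) *
      ((Equiv.Perm.sign (L.1.rowPerm r) : ℤ) * (Equiv.Perm.sign (L.1.colPerm c) : ℤ))) =
    ∑ L : {L : LatinSquare n // L.Reduced}, (L.1.par : ℤ) := by
  let f : {L : LatinSquare n // L.Reduced} → {L : LatinSquare n // L.Reduced} :=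
    fun L => ⟨phi r c L.1, phi_reduced r c L.1⟩
  have hf : Function.Bijective f := by
    apply Finite.injective_iff_bijective.1
    intro L K h
    exact Subtype.ext (phi_inj r c L.1 K.1 L.2 K.2 (congrArg Subtype.val h))
  rw [← hf.sum_comp (fun L => (L.1.par : ℤ))]
  apply Finset.sum_congr rfl
  intro L _
  change _ = (((phi r c L.1).par : ℤˣ) : ℤ)
  rw [phi_par hn]
  push_cast
  ring

open Classical in
theorem card_sub [Fintype {L : LatinSquare n // L.Reduced}] (P : LatinSquare n → Prop) :
    (Nat.card {L : LatinSquare n // L.Reduced ∧ P L} : ℤ) =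
      ∑ L : {L : LatinSquare n // L.Reduced}, if P L.1 then 1 else 0 := by
  rw [← Nat.card_congr (Equiv.subtypeSubtypeEquivSubtypeInter Reduced P),
    Nat.card_eq_fintype_card, Fintype.card_subtype, Finset.card_filter]
  push_cast
  rfl

end LatinSquare

/-- for odd `n`,
`n²(|RELS(n)| − |ROLS(n)|) = Σ_{k,m=0}^{(n−1)/2} (−1)^{k+m}(n−2k)(n−2m) N_n(k,m)`. -/
theorem stmt8 {n : ℕ} [NeZero n] (hn : Odd n) :
    (n : ℤ) ^ 2 *
        ((Nat.card {L : LatinSquare n // L.Reduced ∧ L.par = 1} : ℤ) -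
          (Nat.card {L : LatinSquare n // L.Reduced ∧ L.par = -1} : ℤ)) =
      ∑ k ∈ Finset.range ((n - 1) / 2 + 1), ∑ m ∈ Finset.range ((n - 1) / 2 + 1),
        (-1 : ℤ) ^ (k + m) * ((n : ℤ) - 2 * k) * ((n : ℤ) - 2 * m) *
          (Nat.card {L : LatinSquare n // L.Reduced ∧ L.parityType = (k, m)} : ℤ) := by
  classical
  have : Fintype {L : LatinSquare n // L.Reduced} := Fintype.ofFinite _
  have hL : ((Nat.card {L : LatinSquare n // L.Reduced ∧ L.par = 1} : ℤ) -
          (Nat.card {L : LatinSquare n // L.Reduced ∧ L.par = -1} : ℤ)) =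
      ∑ L : {L : LatinSquare n // L.Reduced}, (L.1.par : ℤ) := by
    rw [LatinSquare.card_sub, LatinSquare.card_sub, ← Finset.sum_sub_distrib]
    apply Finset.sum_congr rfl
    intro L _
    rcases Int.units_eq_one_or L.1.par with h | h <;> simp [h]
  have hR : ∀ L : LatinSquare n,
      (∑ k ∈ Finset.range ((n - 1) / 2 + 1), ∑ m ∈ Finset.range ((n - 1) / 2 + 1),
        (-1 : ℤ) ^ (k + m) * ((n : ℤ) - 2 * k) * ((n : ℤ) - 2 * m) *
          (if L.parityType = (k, m) then 1 else 0)) =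
      ∑ r, ∑ c, ((L.par : ℤ) *
      ((Equiv.Perm.sign (L.rowPerm r) : ℤ) * (Equiv.Perm.sign (L.colPerm c) : ℤ))) := by
    intro L
    obtain ⟨h1, h2⟩ := LatinSquare.sign_sum hn (fun r => Equiv.Perm.sign (L.rowPerm r))
    obtain ⟨h3, h4⟩ := LatinSquare.sign_sum hn (fun r => Equiv.Perm.sign (L.colPerm r))
    unfold LatinSquare.parityType
    rw [Finset.sum_eq_single_of_mem _ (Finset.mem_range.2 h2),
      Finset.sum_eq_single_of_mem _ (Finset.mem_range.2 h4)]
    · rw [if_pos rfl, mul_one, pow_add]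
      simp_rw [← Finset.mul_sum]
      rw [← Finset.sum_mul]
      calc _ = _ := mul_assoc _ _ _
        _ = _ := mul_mul_mul_comm _ _ _ _
        _ = _ := congrArg₂ (· * ·) h1 h3
        _ = _ := by unfold LatinSquare.par; push_cast; ring
    · intro b _ hb
      rw [if_neg, mul_zero]
      intro h
      exact hb (Prod.ext_iff.1 h).2.symm
    · intro b _ hb
      apply Finset.sum_eq_zero
      intro m _
      rw [if_neg, mul_zero]
      intro h
      exact hb (Prod.ext_iff.1 h).1.symm
  rw [hL]
  simp_rw [LatinSquare.card_sub, Finset.mul_sum]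
  rw [← Finset.mul_sum]
  trans ∑ L : {L : LatinSquare n // L.Reduced}, ∑ r, ∑ c, ((L.1.par : ℤ) *
      ((Equiv.Perm.sign (L.1.rowPerm r) : ℤ) * (Equiv.Perm.sign (L.1.colPerm c) : ℤ)))
  · rw [Finset.sum_comm]
    have : ∀ r : Fin n, (∑ L : {L : LatinSquare n // L.Reduced}, ∑ c, ((L.1.par : ℤ) *
      ((Equiv.Perm.sign (L.1.rowPerm r) : ℤ) * (Equiv.Perm.sign (L.1.colPerm c) : ℤ)))) =
        n * ∑ L : {L : LatinSquare n // L.Reduced}, (L.1.par : ℤ) := by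
      intro r
      rw [Finset.sum_comm]
      simp_rw [LatinSquare.sum_shift hn]
      simp
    simp_rw [this]
    simp
    ring
  · simp_rw [← hR]
    rw [Finset.sum_comm]
    apply Finset.sum_congr rfl
    intro k _
    rw [Finset.sum_comm]
    refine Finset.sum_congr rfl fun m _ => Finset.sum_congr rfl fun L _ => ?_
    congr
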